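/- arXiv:2101.01109 — 3 statements merged into one kernel-verified Lean document; each statement's English description precedes it below -/
import Mathlib

section
/- Let n ≥ 1, s ∈ ℝ, 1 ≤ r ≤ 2, and 0 < p < ∞ with p ≤ r'. Set θ := s + n − n/p − n/r. There exists a constant c > 0, depending only on n, s, p, r, such that for every family (u_j)_{j ∈ ℤ} of Schwartz functions on ℝⁿ with supp 𝓕u_j ⊆ {ξ : 2^{j−1} ≤ |ξ| ≤ 3·2^{j−1}} for every j, the function v(ξ) := Σ_{j ∈ ℤ} 𝓕u_j(ξ) (a sum with only finitely many nonzero terms for each ξ ≠ 0, since the supports lie in dyadic annuli) satisfies (∫_{ℝⁿ \ {0}} |ξ|^{θp} |v(ξ)|^p dξ)^{1/p} ≤ c · (Σ_{j ∈ ℤ} (2^{js} ‖u_j‖_{L^r(ℝⁿ)})^p)^{1/p}. -/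
open MeasureTheory SchwartzMap Real FourierTransform ENNReal

theorem plancherel_aux (n : ℕ) (f : EuclideanSpace ℝ (Fin n) → ℂ) (hf : Integrable f)
    (hf2 : MemLp f 2) : eLpNorm (𝓕 f) 2 volume = eLpNorm f 2 volume := by
  set F := hf2.toLp f with hF
  have hcont : Continuous (𝓕 f) :=
    VectorFourier.fourierIntegral_continuous Real.continuous_fourierChar
      (by exact continuous_inner) hf
  have key : ∀ᵐ x ∂(volume : Measure (EuclideanSpace ℝ (Fin n))), 𝓕 f x = (𝓕 F : Lp ℂ 2 (volume : Measure (EuclideanSpace ℝ (Fin n)))) x := by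
    apply ae_eq_of_integral_contDiff_smul_eq hcont.locallyIntegrable
    · exact (Lp.memLp (𝓕 F)).locallyIntegrable (by norm_num)
    · intro g g_smooth g_cpt
      have hg₁ : HasCompactSupport (Complex.ofRealCLM ∘ g) := g_cpt.comp_left rfl
      have hg₂ : ContDiff ℝ (⊤ : ℕ∞) (Complex.ofRealCLM ∘ g) := by fun_prop
      set G := hg₁.toSchwartzMap hg₂ with hG
      have h1 := congrArg (fun T => T G) (Lp.fourier_toTemperedDistribution_eq F)
      simp only [TemperedDistribution.fourier_apply, Lp.toTemperedDistribution_apply] at h1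
      have h2 : ∫ x, 𝓕 G x • F x = ∫ x, 𝓕 G x • f x := by
        apply integral_congr_ae
        filter_upwards [hf2.coeFn_toLp] with x hx
        rw [hx]
      have h3 : ∫ x, 𝓕 G x • f x = ∫ x, G x • 𝓕 f x := by
        have := VectorFourier.integral_bilin_fourierIntegral_eq_flip (μ := volume) (ν := volume) (ContinuousLinearMap.lsmul ℂ ℂ : ℂ →L[ℂ] ℂ →L[ℂ] ℂ) (L := innerₗ (EuclideanSpace ℝ (Fin n))) (f := G) (g := f)
          continuous_fourierChar continuous_inner G.integrable hf
        simpa using! this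
      have h4 : ∀ h : EuclideanSpace ℝ (Fin n) → ℂ, ∫ x, g x • h x = ∫ x, G x • h x := by
        intro h; simp [hG]
      rw [h4, h4, ← h3, ← h2, h1]
  rw [eLpNorm_congr_ae key]
  have := Lp.norm_fourier_eq F
  rw [Lp.norm_def, Lp.norm_def, ENNReal.toReal_eq_toReal_iff' (Lp.eLpNorm_ne_top _) (Lp.eLpNorm_ne_top _)] at this
  rw [this, hF, eLpNorm_congr_ae hf2.coeFn_toLp]

theorem plancherel_lintegral (n : ℕ) (f : EuclideanSpace ℝ (Fin n) → ℂ) (hf : Integrable f)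
    (hf2 : MemLp f 2) : ∫⁻ x, ‖𝓕 f x‖ₑ ^ (2:ℝ) = ∫⁻ x, ‖f x‖ₑ ^ (2:ℝ) := by
  have := plancherel_aux n f hf hf2
  rw [eLpNorm_eq_lintegral_rpow_enorm_toReal (by norm_num) (by norm_num),
    eLpNorm_eq_lintegral_rpow_enorm_toReal (by norm_num) (by norm_num)] at this
  simp only [ENNReal.toReal_ofNat] at this
  exact (ENNReal.rpow_left_injective (by norm_num)) this

theorem dist_bound (n : ℕ) (r : ℝ) (hr : 1 < r) (u : EuclideanSpace ℝ (Fin n) → ℂ)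
    (hu : Integrable u) (hc : Continuous u) (hur : Integrable (fun x => ‖u x‖ ^ r))
    (h1 : ∫ x, ‖u x‖ ^ r ≤ 1) (t : ℝ) (ht : 0 < t) :
    volume {ξ | t < ‖𝓕 u ξ‖} ≤ ENNReal.ofReal (4 * t ^ (-2:ℝ)) *
      ∫⁻ x, Set.indicator {x | ‖u x‖ ≤ (t/2) ^ (-(1/(r-1)))} (fun x => ‖u x‖ₑ ^ (2:ℝ)) x := by
  set τ : ℝ := (t/2) ^ (-(1/(r-1))) with hτ
  have hτ0 : 0 < τ := by positivity
  have hτr : τ ^ (1 - r) = t / 2 := by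
    rw [hτ, ← Real.rpow_mul (by positivity)]
    have : -(1/(r-1)) * (1-r) = 1 := by
      have : r - 1 ≠ 0 := by linarith
      field_simp; ring
    rw [this, Real.rpow_one]
  set S : Set (EuclideanSpace ℝ (Fin n)) := {x | ‖u x‖ ≤ τ} with hS
  have hSm : MeasurableSet S := measurableSet_le hc.norm.measurable measurable_const
  have i1 : Integrable (S.indicator u) := hu.indicator hSm
  have i2 : Integrable (Sᶜ.indicator u) := hu.indicator hSm.compl
  have m1 : MemLp (S.indicator u) 2 := by
    have hi : Integrable (fun x => τ * ‖S.indicator u x‖) := i1.norm.const_mul τ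
    rw [memLp_two_iff_integrable_sq_norm i1.aestronglyMeasurable]
    refine hi.mono' (i1.aestronglyMeasurable.norm.pow 2) (Filter.Eventually.of_forall fun x => ?_)
    have hb : ‖S.indicator u x‖ ≤ τ := by
      by_cases hx : x ∈ S
      · rw [Set.indicator_of_mem hx]; exact hx
      · simp [hx, hτ0.le]
    rw [Real.norm_of_nonneg (by positivity), sq]
    gcongr
  have hadd : ∀ ξ, 𝓕 u ξ = 𝓕 (S.indicator u) ξ + 𝓕 (Sᶜ.indicator u) ξ := by
    intro ξ
    have := VectorFourier.fourierIntegral_add (μ := volume) (L := innerₗ (EuclideanSpace ℝ (Fin n))) continuous_fourierChar continuous_inner i1 i2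
    rw [Set.indicator_self_add_compl] at this
    exact congrFun this ξ
  have h2 : ∀ ξ, ‖𝓕 (Sᶜ.indicator u) ξ‖ ≤ t / 2 := by
    intro ξ
    calc ‖𝓕 (Sᶜ.indicator u) ξ‖ ≤ ∫ x, ‖Sᶜ.indicator u x‖ :=
          VectorFourier.norm_fourierIntegral_le_integral_norm _ _ _ _ _
      _ ≤ ∫ x, (t/2) * ‖u x‖ ^ r := by
          apply integral_mono i2.norm (hur.const_mul _)
          intro x
          by_cases hx : x ∈ S
          · simp [hx]; positivity
          · have hx' : τ < ‖u x‖ := by simpa [hS] using hx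
            have h0 : 0 < ‖u x‖ := hτ0.trans hx'
            simp only [Set.indicator_of_mem (show x ∈ Sᶜ from hx)]
            calc ‖u x‖ = ‖u x‖ ^ (1-r) * ‖u x‖ ^ r := by
                  rw [← Real.rpow_add h0]; simp
              _ ≤ τ ^ (1-r) * ‖u x‖ ^ r := by
                  exact mul_le_mul_of_nonneg_right
                    (Real.rpow_le_rpow_of_nonpos hτ0 hx'.le (by linarith)) (by positivity)
              _ = _ := by rw [hτr]
      _ ≤ (t/2) * 1 := by
          rw [integral_const_mul]; gcongr
      _ = t/2 := by ring
  have hsub : {ξ | t < ‖𝓕 u ξ‖} ⊆ {ξ | ENNReal.ofReal ((t/2)^(2:ℝ)) ≤ ‖𝓕 (S.indicator u) ξ‖ₑ ^ (2:ℝ)} := by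
    intro ξ hξ
    simp only [Set.mem_ofPred_eq] at hξ ⊢
    have : t / 2 ≤ ‖𝓕 (S.indicator u) ξ‖ := by
      rw [hadd] at hξ
      have := norm_add_le (𝓕 (S.indicator u) ξ) (𝓕 (Sᶜ.indicator u) ξ)
      linarith [h2 ξ]
    rw [← ENNReal.ofReal_rpow_of_pos (by positivity), ← ofReal_norm]
    gcongr
  have hcont : Continuous (𝓕 (S.indicator u)) :=
    VectorFourier.fourierIntegral_continuous Real.continuous_fourierChar
      (by exact continuous_inner) i1
  refine (measure_mono hsub).trans ?_
  refine (meas_ge_le_lintegral_div (by fun_prop) (by simp; positivity) (by simp)).trans ?_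
  rw [plancherel_lintegral n _ i1 m1, ENNReal.div_eq_inv_mul, ← ENNReal.ofReal_inv_of_pos (by positivity)]
  apply le_of_eq
  congr 2
  · rw [Real.rpow_neg ht.le, Real.rpow_ofNat, Real.rpow_ofNat]; field_simp; norm_num
  · ext x
    by_cases hx : x ∈ S <;> simp [hx]

theorem inner_bound (q r a : ℝ) (hq : 2 < q) (hr : 1 < r) (ha : 0 < a) (hqr : (r-1)*q = r) :
    (∫⁻ t in Set.Ioi (0:ℝ), Set.indicator {t : ℝ | a ≤ (t/2) ^ (-(1/(r-1)))}
      (fun t => ENNReal.ofReal (t ^ (q-3))) t) * ENNReal.ofReal (a ^ (2:ℝ))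
      ≤ ENNReal.ofReal (2^(q-2) / (q-2)) * ENNReal.ofReal (a ^ r) := by
  set b : ℝ := 2 * a ^ (1-r) with hb
  have hb0 : 0 < b := by positivity
  have h1 : (∫⁻ t in Set.Ioi (0:ℝ), Set.indicator {t : ℝ | a ≤ (t/2) ^ (-(1/(r-1)))}
      (fun t => ENNReal.ofReal (t ^ (q-3))) t) ≤ ∫⁻ t in Set.Ioc 0 b, ENNReal.ofReal (t ^ (q-3)) := by
    rw [← lintegral_indicator measurableSet_Ioi, ← lintegral_indicator measurableSet_Ioc]
    apply lintegral_mono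
    intro t
    by_cases ht : 0 < t
    · by_cases h : a ≤ (t/2) ^ (-(1/(r-1)))
      · have htb : t ≤ b := by
          have : ((t/2) ^ (-(1/(r-1)))) ^ (1 - r) ≤ a ^ (1-r) :=
            Real.rpow_le_rpow_of_nonpos ha h (by linarith)
          rw [← Real.rpow_mul (by positivity)] at this
          have e : -(1/(r-1)) * (1-r) = 1 := by
            have : r - 1 ≠ 0 := by linarith
            field_simp; ring
          rw [e, Real.rpow_one] at this
          rw [hb]; linarith
        rw [Set.indicator_of_mem (show t ∈ Set.Ioi 0 from ht), Set.indicator_of_mem (show t ∈ {t : ℝ | a ≤ (t/2) ^ (-(1/(r-1)))} from h),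
          Set.indicator_of_mem (show t ∈ Set.Ioc 0 b from ⟨ht, htb⟩)]
      · rw [Set.indicator_of_mem (show t ∈ Set.Ioi 0 from ht), Set.indicator_of_notMem (show t ∉ {t : ℝ | a ≤ (t/2) ^ (-(1/(r-1)))} from h)]
        exact zero_le
    · simp [Set.indicator, ht]
  have h2 : ∫⁻ t in Set.Ioc 0 b, ENNReal.ofReal (t ^ (q-3)) = ENNReal.ofReal (b ^ (q-2) / (q-2)) := by
    rw [← ofReal_integral_eq_lintegral_ofReal]
    · rw [← intervalIntegral.integral_of_le hb0.le, integral_rpow (Or.inl (by linarith))]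
      rw [show q - 3 + 1 = q - 2 by ring, Real.zero_rpow (by linarith)]; simp
    · exact (intervalIntegrable_iff_integrableOn_Ioc_of_le hb0.le).1 (intervalIntegral.intervalIntegrable_rpow' (by linarith))
    · filter_upwards [self_mem_ae_restrict measurableSet_Ioc] with t ht
      exact Real.rpow_nonneg ht.1.le _
  refine (mul_le_mul_left (h1.trans h2.le) _).trans ?_
  rw [← ENNReal.ofReal_mul (by have := sub_pos.2 hq; positivity), ← ENNReal.ofReal_mul (by have := sub_pos.2 hq; positivity)]
  apply le_of_eq
  congr 1
  rw [hb, Real.mul_rpow (by norm_num) (by positivity), ← Real.rpow_mul ha.le]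
  have : a ^ ((1-r)*(q-2)) * a ^ (2:ℝ) = a ^ r := by
    rw [← Real.rpow_add ha]; congr 1; nlinarith
  rw [← this]; ring

theorem HY_norm (n : ℕ) (q r : ℝ) (hq : 2 < q) (hr : 1 < r) (hqr : (r-1)*q = r)
    (u : EuclideanSpace ℝ (Fin n) → ℂ)
    (hu : Integrable u) (hc : Continuous u) (hur : Integrable (fun x => ‖u x‖ ^ r))
    (h1 : ∫ x, ‖u x‖ ^ r ≤ 1) :
    ∫⁻ ξ, ENNReal.ofReal (‖𝓕 u ξ‖ ^ q) ≤ ENNReal.ofReal q * (4 * ENNReal.ofReal (2^(q-2) / (q-2))) := by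
  have hcont : Continuous (𝓕 u) :=
    VectorFourier.fourierIntegral_continuous Real.continuous_fourierChar
      (by exact continuous_inner) hu
  rw [lintegral_rpow_eq_lintegral_meas_lt_mul volume (Filter.Eventually.of_forall fun x => norm_nonneg _) hcont.norm.aemeasurable (by linarith)]
  gcongr
  set P : Set (ℝ × EuclideanSpace ℝ (Fin n)) := {z | ‖u z.2‖ ≤ (z.1/2) ^ (-(1/(r-1)))} with hP
  have hPm : MeasurableSet P := measurableSet_le (by fun_prop) (by fun_prop)
  set G : ℝ × EuclideanSpace ℝ (Fin n) → ℝ≥0∞ := P.indicator (fun z => ‖u z.2‖ₑ ^ (2:ℝ) * ENNReal.ofReal (z.1 ^ (q-3))) with hG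
  have hGm : Measurable G := Measurable.indicator (by have := hc.measurable; fun_prop) hPm
  calc ∫⁻ t in Set.Ioi 0, volume {ξ | t < ‖𝓕 u ξ‖} * ENNReal.ofReal (t ^ (q-1))
      ≤ ∫⁻ t in Set.Ioi (0:ℝ), 4 * ∫⁻ x, G (t, x) := by
        apply setLIntegral_mono' measurableSet_Ioi
        intro t ht
        have ht : 0 < t := ht
        refine (mul_le_mul_left (dist_bound n r hr u hu hc hur h1 t ht) _).trans ?_
        apply le_of_eq
        have e1 : ENNReal.ofReal (4 * t ^ (-2:ℝ)) * ENNReal.ofReal (t ^ (q-1)) = 4 * ENNReal.ofReal (t ^ (q-3)) := by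
          rw [← ENNReal.ofReal_mul (by positivity), mul_assoc, ← Real.rpow_add ht, ENNReal.ofReal_mul (by norm_num)]
          congr 2
          · simp
          · congr 1; ring
        rw [mul_right_comm, e1, mul_assoc, ← lintegral_const_mul' _ _ ENNReal.ofReal_ne_top]
        congr 2
        ext x
        simp only [hG, hP, Set.indicator, Set.mem_ofPred_eq]
        split_ifs <;> simp [mul_comm]
    _ = 4 * ∫⁻ x, ∫⁻ t in Set.Ioi (0:ℝ), G (t, x) := by
        rw [lintegral_const_mul' _ _ (by norm_num), lintegral_lintegral_swap]
        exact hGm.aemeasurable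
    _ ≤ 4 * ∫⁻ x, ENNReal.ofReal (2^(q-2) / (q-2)) * ENNReal.ofReal (‖u x‖ ^ r) := by
        gcongr with x
        by_cases hx : u x = 0
        · have : ∀ t, G (t, x) = 0 := by intro t; simp [hG, Set.indicator, hx]
          simp [this]
        · refine le_trans (le_of_eq ?_) (inner_bound q r ‖u x‖ hq hr (norm_pos_iff.2 hx) hqr)
          rw [← lintegral_mul_const' _ _ ENNReal.ofReal_ne_top]
          congr 1
          ext t
          simp only [hG, hP, Set.indicator, Set.mem_ofPred_eq]
          split_ifs
          · rw [mul_comm, ← ofReal_norm, ENNReal.ofReal_rpow_of_nonneg (by positivity) (by norm_num)]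
          · simp
    _ ≤ 4 * ENNReal.ofReal (2^(q-2) / (q-2)) := by
        rw [lintegral_const_mul' _ _ ENNReal.ofReal_ne_top, ← ofReal_integral_eq_lintegral_ofReal hur (Filter.Eventually.of_forall fun x => by positivity)]
        gcongr
        refine le_trans (mul_le_mul_right (ENNReal.ofReal_le_ofReal h1) _) ?_
        simp

theorem HY_mid (n : ℕ) (q r : ℝ) (hq : 2 < q) (hr : 1 < r) (hqr : (r-1)*q = r) :
    ∃ K : ℝ≥0∞, K ≠ ⊤ ∧ ∀ u : SchwartzMap (EuclideanSpace ℝ (Fin n)) ℂ,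
      eLpNorm (𝓕 (⇑u)) (ENNReal.ofReal q) volume ≤ K * eLpNorm (⇑u) (ENNReal.ofReal r) volume := by
  refine ⟨(ENNReal.ofReal q * (4 * ENNReal.ofReal (2^(q-2) / (q-2)))) ^ (1/q), ?_, ?_⟩
  · exact ENNReal.rpow_ne_top_of_nonneg (by positivity) (ENNReal.mul_ne_top ENNReal.ofReal_ne_top (ENNReal.mul_ne_top (by norm_num) ENNReal.ofReal_ne_top))
  intro u
  have hr0 : ENNReal.ofReal r ≠ 0 := by simp; linarith
  have hq0 : ENNReal.ofReal q ≠ 0 := by simp; linarith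
  have hmem : MemLp (⇑u) (ENNReal.ofReal r) volume := u.memLp _ _
  set a := (eLpNorm (⇑u) (ENNReal.ofReal r) volume).toReal with ha
  have haA : eLpNorm (⇑u) (ENNReal.ofReal r) volume = ENNReal.ofReal a :=
    (ENNReal.ofReal_toReal hmem.eLpNorm_ne_top).symm
  have hur : Integrable (fun x => ‖u x‖ ^ r) := by
    have := hmem.integrable_norm_rpow hr0 ENNReal.ofReal_ne_top
    rwa [ENNReal.toReal_ofReal (by linarith)] at this
  have hI : ∫ x, ‖u x‖ ^ r = a ^ r := by
    have h := hmem.eLpNorm_eq_integral_rpow_norm hr0 ENNReal.ofReal_ne_top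
    rw [ENNReal.toReal_ofReal (by linarith)] at h
    have h0 : 0 ≤ ∫ x, ‖u x‖ ^ r := integral_nonneg fun x => by positivity
    rw [ha, h, ENNReal.toReal_ofReal (by positivity), ← Real.rpow_mul h0, inv_mul_cancel₀ (by linarith), Real.rpow_one]
  rcases eq_or_ne a 0 with h0 | h0
  · have hz : ⇑u =ᵐ[volume] 0 := by
      rw [h0, ENNReal.ofReal_zero, eLpNorm_eq_zero_iff hmem.1 hr0] at haA
      exact haA
    have : 𝓕 (⇑u) = 0 := by
      ext ξ
      rw [Real.fourier_eq]
      rw [integral_eq_zero_of_ae]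
      · rfl
      · filter_upwards [hz] with x hx
        simp [hx]
    rw [this]; simp
  have ha0 : 0 < a := lt_of_le_of_ne ENNReal.toReal_nonneg h0.symm
  set w : EuclideanSpace ℝ (Fin n) → ℂ := fun x => ((a⁻¹ : ℝ) : ℂ) • u x with hw
  have huw : ⇑u = ((a:ℝ):ℂ) • w := by
    ext x; simp [hw, h0]
  have hwn : ∀ x, ‖w x‖ ^ r = a⁻¹ ^ r * ‖u x‖ ^ r := by
    intro x
    rw [hw, norm_smul, Real.mul_rpow (by positivity) (by positivity)]
    simp [abs_of_pos ha0]
  have hfw : 𝓕 (⇑u) = ((a:ℝ):ℂ) • 𝓕 w := by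
    rw [huw]
    exact VectorFourier.fourierIntegral_const_smul _ _ _ _ _
  have key := HY_norm n q r hq hr hqr w (by exact u.integrable.smul ((a⁻¹ : ℝ) : ℂ)) (by fun_prop) (by simp_rw [hwn]; exact hur.const_mul _)
    (by
      simp_rw [hwn]
      rw [integral_const_mul, hI, ← Real.mul_rpow (by positivity) (by positivity), inv_mul_cancel₀ h0, Real.one_rpow])
  rw [hfw, eLpNorm_const_smul, haA, mul_comm]
  have e : ‖((a:ℝ):ℂ)‖ₑ = ENNReal.ofReal a := by
    rw [← ofReal_norm]; simp [abs_of_pos ha0]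
  rw [e]
  gcongr
  rw [eLpNorm_eq_lintegral_rpow_enorm_toReal hq0 ENNReal.ofReal_ne_top, ENNReal.toReal_ofReal (by linarith)]
  gcongr
  refine le_trans (le_of_eq ?_) key
  congr 1; ext ξ
  rw [← ofReal_norm, ENNReal.ofReal_rpow_of_nonneg (by positivity) (by linarith)]

theorem HY (n : ℕ) (r : ℝ) (r' : ℝ≥0∞) (hr1 : 1 ≤ r) (hr2 : r ≤ 2)
    (hconj : 1 / ENNReal.ofReal r + 1 / r' = 1) :
    ∃ K : ℝ≥0∞, K ≠ ⊤ ∧ ∀ u : SchwartzMap (EuclideanSpace ℝ (Fin n)) ℂ,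
      eLpNorm (𝓕 (⇑u)) r' volume ≤ K * eLpNorm (⇑u) (ENNReal.ofReal r) volume := by
  rcases eq_or_lt_of_le hr1 with h | hr1
  · subst h
    have : r' = ⊤ := by
      simp only [ENNReal.ofReal_one, div_one, one_div] at hconj
      have : r'⁻¹ = 0 := by
        have h : (1:ℝ≥0∞) + r'⁻¹ = 1 + 0 := by rw [hconj, add_zero]
        exact (ENNReal.add_right_inj (by norm_num)).1 h
      simpa using this
    subst this
    refine ⟨1, by norm_num, fun u => ?_⟩
    rw [one_mul, eLpNorm_exponent_top, ENNReal.ofReal_one]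
    apply eLpNormEssSup_le_of_ae_enorm_bound
    refine Filter.Eventually.of_forall fun ξ => ?_
    rw [eLpNorm_one_eq_lintegral_enorm, ← ofReal_norm, ← ofReal_integral_norm_eq_lintegral_enorm u.integrable]
    apply ENNReal.ofReal_le_ofReal
    exact VectorFourier.norm_fourierIntegral_le_integral_norm _ _ _ _ _
  have hr0 : 0 < r := by linarith
  have hne0 : r' ≠ 0 := by
    rintro rfl; simp at hconj
  have hnet : r' ≠ ⊤ := by
    rintro rfl
    simp at hconj
    linarith
  set q := r'.toReal with hq
  have hq0 : 0 < q := ENNReal.toReal_pos hne0 hnet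
  have hr' : r' = ENNReal.ofReal q := (ENNReal.ofReal_toReal hnet).symm
  have hqr : 1 / r + 1 / q = 1 := by
    rw [hr', ← ENNReal.ofReal_one, ← ENNReal.ofReal_div_of_pos hr0, ← ENNReal.ofReal_div_of_pos hq0,
      ← ENNReal.ofReal_add (by positivity) (by positivity), ENNReal.ofReal_eq_ofReal_iff (by positivity) (by positivity)] at hconj
    exact hconj
  have hqr' : (r-1) * q = r := by
    field_simp at hqr; linarith
  rcases eq_or_lt_of_le hr2 with h | hr2
  · subst h
    have : q = 2 := by linarith
    rw [hr', this]
    refine ⟨1, by norm_num, fun u => ?_⟩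
    rw [one_mul]
    have : ENNReal.ofReal 2 = 2 := by simp
    rw [this]
    exact (plancherel_aux n u u.integrable (u.memLp _ _)).le
  · rw [hr']
    apply HY_mid n q r _ hr1 hqr'
    nlinarith

theorem annulus_rpow (e R y : ℝ) (hR : 0 < R) (h1 : R ≤ y) (h2 : y ≤ 3 * R) :
    y ^ e ≤ 3 ^ |e| * R ^ e := by
  obtain ⟨z, rfl⟩ : ∃ z, y = R * z := ⟨y / R, by field_simp⟩
  have hz1 : 1 ≤ z := by
    by_contra h; push Not at h; nlinarith
  have hz3 : z ≤ 3 := by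
    by_contra h; push Not at h; nlinarith
  rw [Real.mul_rpow hR.le (by linarith), mul_comm]
  gcongr
  calc z ^ e ≤ z ^ |e| := Real.rpow_le_rpow_of_exponent_le hz1 (le_abs_self e)
    _ ≤ 3 ^ |e| := by gcongr

theorem piece (n : ℕ) (s r p θ : ℝ) (r' : ℝ≥0∞)
    (hr1 : 1 ≤ r) (hr2 : r ≤ 2)
    (hconj : 1 / ENNReal.ofReal r + 1 / r' = 1)
    (hp0 : 0 < p) (hpr' : ENNReal.ofReal p ≤ r')
    (hθ : θ = s + n - n / p - n / r) :
    ∃ K : ℝ≥0∞, K ≠ ⊤ ∧ ∀ (j : ℤ) (u : SchwartzMap (EuclideanSpace ℝ (Fin n)) ℂ),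
      Function.support (𝓕 (⇑u)) ⊆
        {ξ : EuclideanSpace ℝ (Fin n) | (2:ℝ) ^ (j-1) ≤ ‖ξ‖ ∧ ‖ξ‖ ≤ 3 * (2:ℝ) ^ (j-1)} →
      ∫⁻ ξ, ENNReal.ofReal (‖ξ‖ ^ (θ * p)) * ‖𝓕 (⇑u) ξ‖ₑ ^ p ≤
        K * (ENNReal.ofReal ((2:ℝ) ^ ((j:ℝ) * s)) *
                eLpNorm (⇑u) (ENNReal.ofReal r) volume) ^ p := by
  obtain ⟨H, hH, hHY⟩ := HY n r r' hr1 hr2 hconj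
  have hr0 : 0 < r := by linarith
  have hne0 : r' ≠ 0 := by
    rintro rfl; simp at hconj
  set q := r'.toReal with hq
  have hqr : 1 / r + 1 / q = 1 := by
    have := congrArg ENNReal.toReal hconj
    rw [ENNReal.toReal_add (by simp [hr0]) (by simp [hne0])] at this
    simpa [hr0.le] using this
  set δ : ℝ := 1 / p - 1 / q with hδ
  have hδ0 : 0 ≤ δ := by
    rw [hδ, sub_nonneg]
    rcases eq_or_ne r' ⊤ with h | h
    · simp [hq, h, hp0.le]
    · have : p ≤ q := (ENNReal.ofReal_le_iff_le_toReal h).1 hpr'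
      gcongr
  set V := volume (Metric.ball (0 : EuclideanSpace ℝ (Fin n)) 1) with hV
  have hVt : V ≠ ⊤ := measure_ball_lt_top.ne
  refine ⟨ENNReal.ofReal (3 ^ |θ * p|) * (H * (ENNReal.ofReal (3^n) * V) ^ δ) ^ p * ENNReal.ofReal (2 ^ (-s)) ^ p,
    ?_, ?_⟩
  · refine ENNReal.mul_ne_top (ENNReal.mul_ne_top ENNReal.ofReal_ne_top (ENNReal.rpow_ne_top_of_nonneg hp0.le ?_)) (ENNReal.rpow_ne_top_of_nonneg hp0.le ENNReal.ofReal_ne_top)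
    exact ENNReal.mul_ne_top hH (ENNReal.rpow_ne_top_of_nonneg hδ0 (ENNReal.mul_ne_top ENNReal.ofReal_ne_top hVt))
  intro j u hu
  set R : ℝ := (2:ℝ) ^ (j-1) with hR
  have hR0 : 0 < R := by positivity
  set A : Set (EuclideanSpace ℝ (Fin n)) := {ξ | R ≤ ‖ξ‖ ∧ ‖ξ‖ ≤ 3 * R} with hA
  have hAm : MeasurableSet A :=
    (measurableSet_le measurable_const measurable_norm).inter (measurableSet_le measurable_norm measurable_const)
  set X := ENNReal.ofReal R with hX
  have hX0 : X ≠ 0 := by simp [hX, hR0]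
  have hXt : X ≠ ⊤ := ENNReal.ofReal_ne_top
  set N := eLpNorm (⇑u) (ENNReal.ofReal r) volume with hN
  have hcont : Continuous (𝓕 (⇑u)) :=
    VectorFourier.fourierIntegral_continuous Real.continuous_fourierChar
      (by exact continuous_inner) u.integrable
  have hvol : volume A ≤ (ENNReal.ofReal (3^n) * V) * X ^ (n:ℝ) := by
    calc volume A ≤ volume (Metric.closedBall (0 : EuclideanSpace ℝ (Fin n)) (3 * R)) := by
          apply measure_mono
          intro ξ hξ
          simpa using hξ.2
      _ = _ := by
          rw [Measure.addHaar_closedBall _ _ (by positivity), finrank_euclideanSpace_fin, mul_pow,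
            ENNReal.ofReal_mul (by positivity), ENNReal.rpow_natCast, hX, ← ENNReal.ofReal_pow hR0.le]
          ring
  have hLp : ∫⁻ ξ in A, ‖𝓕 (⇑u) ξ‖ₑ ^ p ≤ (H * N * ((ENNReal.ofReal (3^n) * V) * X ^ (n:ℝ)) ^ δ) ^ p := by
    have h1 := eLpNorm_le_eLpNorm_mul_rpow_measure_univ hpr' (hcont.aestronglyMeasurable (μ := volume.restrict A))
    rw [ENNReal.toReal_ofReal hp0.le, Measure.restrict_apply_univ,
      eLpNorm_eq_lintegral_rpow_enorm_toReal (by simp [hp0]) ENNReal.ofReal_ne_top, ENNReal.toReal_ofReal hp0.le] at h1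
    have h2 : (∫⁻ ξ in A, ‖𝓕 (⇑u) ξ‖ₑ ^ p) = ((∫⁻ ξ in A, ‖𝓕 (⇑u) ξ‖ₑ ^ p) ^ (1/p)) ^ p := by
      rw [← ENNReal.rpow_mul, one_div_mul_cancel hp0.ne', ENNReal.rpow_one]
    rw [h2]
    gcongr
    refine h1.trans ?_
    gcongr
    exact (eLpNorm_mono_measure _ Measure.restrict_le_self).trans (hHY u)
  calc ∫⁻ ξ, ENNReal.ofReal (‖ξ‖ ^ (θ * p)) * ‖𝓕 (⇑u) ξ‖ₑ ^ p
      ≤ ∫⁻ ξ, A.indicator (fun ξ => ENNReal.ofReal (3 ^ |θ * p| * R ^ (θ * p)) * ‖𝓕 (⇑u) ξ‖ₑ ^ p) ξ := by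
        apply lintegral_mono
        intro ξ
        by_cases h : ξ ∈ A
        · rw [Set.indicator_of_mem h]
          dsimp only
          gcongr
          exact annulus_rpow _ _ _ hR0 h.1 h.2
        · have : 𝓕 (⇑u) ξ = 0 := by
            by_contra h'
            exact h (hu h')
          simp [this, hp0]
    _ = ENNReal.ofReal (3 ^ |θ * p| * R ^ (θ * p)) * ∫⁻ ξ in A, ‖𝓕 (⇑u) ξ‖ₑ ^ p := by
        rw [lintegral_indicator hAm, lintegral_const_mul' _ _ ENNReal.ofReal_ne_top]
    _ ≤ ENNReal.ofReal (3 ^ |θ * p| * R ^ (θ * p)) * (H * N * ((ENNReal.ofReal (3^n) * V) * X ^ (n:ℝ)) ^ δ) ^ p := by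
        gcongr
    _ = _ := by
        set W := ENNReal.ofReal (3^n) * V with hW
        have e1 : ENNReal.ofReal (3 ^ |θ * p| * R ^ (θ * p)) = ENNReal.ofReal (3 ^ |θ * p|) * X ^ (θ * p) := by
          rw [ENNReal.ofReal_mul (by positivity), hX, ENNReal.ofReal_rpow_of_pos hR0]
        have e2 : ENNReal.ofReal ((2:ℝ) ^ ((j:ℝ) * s)) = ENNReal.ofReal (2 ^ s) * X ^ s := by
          rw [hX, ENNReal.ofReal_rpow_of_pos hR0, ← ENNReal.ofReal_mul (by positivity)]
          congr 1
          rw [hR, ← Real.rpow_intCast, ← Real.rpow_mul (by norm_num), ← Real.rpow_add (by norm_num)]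
          congr 1
          push_cast; ring
        have e3 : ENNReal.ofReal (2 ^ (-s)) ^ p * ENNReal.ofReal (2 ^ s) ^ p = 1 := by
          rw [← ENNReal.mul_rpow_of_nonneg _ _ hp0.le, ← ENNReal.ofReal_mul (by positivity), ← Real.rpow_add (by norm_num)]
          simp
        have e4 : X ^ (θ * p) * X ^ (n * δ * p) = X ^ (s * p) := by
          rw [← ENNReal.rpow_add _ _ hX0 hXt]
          congr 1
          have : θ + n * δ = s := by
            have h3 : (n:ℝ) / r + n * (1 / q) = n := by
              have : (n:ℝ) / r + n * (1 / q) = n * (1 / r + 1 / q) := by ring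
              rw [this, hqr, mul_one]
            rw [hθ, hδ, mul_sub, mul_one_div]
            linarith
          rw [← this]; ring
        rw [e1, e2]
        simp only [ENNReal.mul_rpow_of_nonneg _ _ hp0.le, ENNReal.mul_rpow_of_nonneg _ _ hδ0, ← ENNReal.rpow_mul]
        calc _ = ENNReal.ofReal (3 ^ |θ * p|) * (H ^ p * N ^ p * W ^ (δ * p)) * (X ^ (θ * p) * X ^ (n * δ * p)) := by
              ring
          _ = ENNReal.ofReal (3 ^ |θ * p|) * (H ^ p * N ^ p * W ^ (δ * p)) * X ^ (s * p) * (ENNReal.ofReal (2 ^ (-s)) ^ p * ENNReal.ofReal (2 ^ s) ^ p) := by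
              rw [e4, e3, mul_one]
          _ = _ := by ring

theorem pointwise_sum (n : ℕ) (p : ℝ) (hp0 : 0 < p) (f : ℤ → EuclideanSpace ℝ (Fin n) → ℂ)
    (hf : ∀ j : ℤ, Function.support (f j) ⊆
        {ξ : EuclideanSpace ℝ (Fin n) | (2:ℝ) ^ (j-1) ≤ ‖ξ‖ ∧ ‖ξ‖ ≤ 3 * (2:ℝ) ^ (j-1)})
    (ξ : EuclideanSpace ℝ (Fin n)) (hξ : ξ ≠ 0) :
    ‖∑' j : ℤ, f j ξ‖ₑ ^ p ≤ 2 ^ p * ∑' j : ℤ, ‖f j ξ‖ₑ ^ p := by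
  obtain ⟨m, hm1, hm2⟩ := _root_.exists_mem_Ico_zpow (norm_pos_iff.2 hξ) (one_lt_two (α := ℝ))
  have hz : ∀ j ∉ ({m, m+1} : Finset ℤ), f j ξ = 0 := by
    intro j hj
    by_contra h
    obtain ⟨h1, h2⟩ := hf j h
    apply hj
    have a1 : j - 1 < m + 1 := (zpow_lt_zpow_iff_right₀ (one_lt_two (α := ℝ))).1 (h1.trans_lt hm2)
    have a2 : m < j - 1 + 2 := by
      apply (zpow_lt_zpow_iff_right₀ (one_lt_two (α := ℝ))).1
      rw [zpow_add₀ (by norm_num)]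
      have : (0:ℝ) < 2 ^ (j-1) := by positivity
      norm_num
      linarith
    simp only [Finset.mem_insert, Finset.mem_singleton]
    omega
  rw [tsum_eq_sum hz, Finset.sum_pair (by omega)]
  set a := ‖f m ξ‖ₑ with ha
  set b := ‖f (m+1) ξ‖ₑ with hb
  have h1 : ‖f m ξ + f (m+1) ξ‖ₑ ≤ 2 * max a b := by
    refine (enorm_add_le _ _).trans ?_
    rw [two_mul]
    exact add_le_add (le_max_left _ _) (le_max_right _ _)
  have h2 : (max a b) ^ p ≤ ∑' j : ℤ, ‖f j ξ‖ₑ ^ p := by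
    rcases max_choice a b with h | h <;> rw [h]
    · exact ENNReal.le_tsum (f := fun j : ℤ => ‖f j ξ‖ₑ ^ p) m
    · exact ENNReal.le_tsum (f := fun j : ℤ => ‖f j ξ‖ₑ ^ p) (m+1)
  calc _ ≤ (2 * max a b) ^ p := by gcongr
    _ = 2 ^ p * (max a b) ^ p := ENNReal.mul_rpow_of_nonneg _ _ hp0.le
    _ ≤ _ := by gcongr

/-- General Szasz estimate for a family of dyadically supported pieces:
for `1 ≤ r ≤ 2`, `0 < p < ∞`, `p ≤ r'`, and `θ = s + n - n/p - n/r`, there is a constant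
`c = c(n,s,p,r) > 0` such that for every family `(u_j)_{j ∈ ℤ}` of Schwartz functions with
`supp 𝓕 u_j ⊆ {2^{j-1} ≤ |ξ| ≤ 3·2^{j-1}}`, the function `v(ξ) = Σ_j 𝓕 u_j(ξ)` satisfies
`(∫_{ξ ≠ 0} |ξ|^{θp} |v(ξ)|^p dξ)^{1/p} ≤ c (Σ_j (2^{js} ‖u_j‖_{L^r})^p)^{1/p}`. -/
theorem stmt1 (n : ℕ) (hn : 1 ≤ n) (s r p θ : ℝ) (r' : ℝ≥0∞)
    (hr1 : 1 ≤ r) (hr2 : r ≤ 2)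
    (hconj : 1 / ENNReal.ofReal r + 1 / r' = 1)
    (hp0 : 0 < p) (hpr' : ENNReal.ofReal p ≤ r')
    (hθ : θ = s + n - n / p - n / r) :
    ∃ c > 0, ∀ (u : ℤ → SchwartzMap (EuclideanSpace ℝ (Fin n)) ℂ),
      (∀ j : ℤ, Function.support (𝓕 (⇑(u j))) ⊆
        {ξ : EuclideanSpace ℝ (Fin n) | (2:ℝ) ^ (j-1) ≤ ‖ξ‖ ∧ ‖ξ‖ ≤ 3 * (2:ℝ) ^ (j-1)}) →
      ∀ v : EuclideanSpace ℝ (Fin n) → ℂ,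
        (v = fun ξ => ∑' j : ℤ, 𝓕 (⇑(u j)) ξ) →
        (∫⁻ ξ in ({0}ᶜ : Set (EuclideanSpace ℝ (Fin n))),
            ENNReal.ofReal (‖ξ‖ ^ (θ * p)) * (‖v ξ‖₊ : ℝ≥0∞) ^ p) ^ (1/p)
          ≤ ENNReal.ofReal c *
            (∑' j : ℤ, (ENNReal.ofReal ((2:ℝ) ^ ((j:ℝ) * s)) *
                eLpNorm (⇑(u j)) (ENNReal.ofReal r) volume) ^ p) ^ (1/p) := by
  obtain ⟨K, hK, hpiece⟩ := piece n s r p θ r' hr1 hr2 hconj hp0 hpr' hθ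
  refine ⟨((2 ^ p * K) ^ (1/p)).toReal + 1, by positivity, ?_⟩
  rintro u hu v rfl
  have hcont : ∀ j, Continuous (𝓕 (⇑(u j))) := fun j =>
    VectorFourier.fourierIntegral_continuous Real.continuous_fourierChar
      (by exact continuous_inner) (u j).integrable
  have hfin : (2 ^ p * K) ^ (1/p) ≠ ⊤ :=
    ENNReal.rpow_ne_top_of_nonneg (by positivity)
      (ENNReal.mul_ne_top (ENNReal.rpow_ne_top_of_nonneg hp0.le (by norm_num)) hK)
  have hc : (2 ^ p * K) ^ (1/p) ≤ ENNReal.ofReal (((2 ^ p * K) ^ (1/p)).toReal + 1) := by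
    rw [ENNReal.le_ofReal_iff_toReal_le hfin (by positivity)]
    linarith
  set T := ∑' j : ℤ, (ENNReal.ofReal ((2:ℝ) ^ ((j:ℝ) * s)) *
                eLpNorm (⇑(u j)) (ENNReal.ofReal r) volume) ^ p with hT
  have main : (∫⁻ ξ in ({0}ᶜ : Set (EuclideanSpace ℝ (Fin n))),
            ENNReal.ofReal (‖ξ‖ ^ (θ * p)) * (‖∑' j : ℤ, 𝓕 (⇑(u j)) ξ‖₊ : ℝ≥0∞) ^ p) ≤ (2 ^ p * K) * T := by
    calc _ ≤ ∫⁻ ξ in ({0}ᶜ : Set (EuclideanSpace ℝ (Fin n))),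
            2 ^ p * ∑' j : ℤ, ENNReal.ofReal (‖ξ‖ ^ (θ * p)) * ‖𝓕 (⇑(u j)) ξ‖ₑ ^ p := by
          apply setLIntegral_mono' (measurableSet_singleton _).compl
          intro ξ hξ
          rw [ENNReal.tsum_mul_left, mul_left_comm]
          gcongr
          exact pointwise_sum n p hp0 (fun j => 𝓕 (⇑(u j))) hu ξ hξ
      _ ≤ ∫⁻ ξ, 2 ^ p * ∑' j : ℤ, ENNReal.ofReal (‖ξ‖ ^ (θ * p)) * ‖𝓕 (⇑(u j)) ξ‖ₑ ^ p :=
          setLIntegral_le_lintegral _ _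
      _ = 2 ^ p * ∑' j : ℤ, ∫⁻ ξ, ENNReal.ofReal (‖ξ‖ ^ (θ * p)) * ‖𝓕 (⇑(u j)) ξ‖ₑ ^ p := by
          rw [lintegral_const_mul' _ _ (ENNReal.rpow_ne_top_of_nonneg hp0.le (by norm_num)), lintegral_tsum]
          intro j
          have := (hcont j).measurable
          fun_prop
      _ ≤ 2 ^ p * ∑' j : ℤ, K * (ENNReal.ofReal ((2:ℝ) ^ ((j:ℝ) * s)) *
                eLpNorm (⇑(u j)) (ENNReal.ofReal r) volume) ^ p := by
          gcongr with j
          exact hpiece j (u j) (hu j)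
      _ = _ := by rw [ENNReal.tsum_mul_left, mul_assoc]
  calc _ ≤ ((2 ^ p * K) * T) ^ (1/p) := by gcongr
    _ = (2 ^ p * K) ^ (1/p) * T ^ (1/p) := ENNReal.mul_rpow_of_nonneg _ _ (by positivity)
    _ ≤ _ := by gcongr
end

section
/- Let n ≥ 1 and let T be a tempered distribution on ℝⁿ, i.e., a continuous linear functional on the Schwartz space 𝓢(ℝⁿ, ℂ). If T(𝓕φ) = 0 for every Schwartz function φ that vanishes on some neighborhood of 0, then T is a polynomial distribution: there exists a polynomial function P : ℝⁿ → ℂ such that T(ψ) = ∫_{ℝⁿ} P(x) ψ(x) dx for every Schwartz function ψ. -/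
open MeasureTheory SchwartzMap Real FourierTransform

open LineDeriv in
lemma aux_fourier (n : ℕ) (m : ℕ) (v : Fin m → Fin n) :
    ∃ P : MvPolynomial (Fin n) ℂ, ∀ ψ : SchwartzMap (EuclideanSpace ℝ (Fin n)) ℂ,
      ∃ g : SchwartzMap (EuclideanSpace ℝ (Fin n)) ℂ,
        (∀ x, g x = MvPolynomial.eval (fun i => ((x i : ℝ) : ℂ)) P * ψ x) ∧
        ∂^{fun i => EuclideanSpace.single (v i) (1:ℝ)} (𝓕⁻ ψ) = 𝓕⁻ g := by
  induction m with
  | zero => exact ⟨1, fun ψ => ⟨ψ, by simp, by simp⟩⟩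
  | succ m ih =>
    obtain ⟨P, hP⟩ := ih (Fin.tail v)
    refine ⟨MvPolynomial.C (2 * π * Complex.I) * MvPolynomial.X (v 0) * P, fun ψ => ?_⟩
    obtain ⟨g, hg, hd⟩ := hP ψ
    refine ⟨(2 * π * Complex.I) • smulLeftCLM ℂ (inner ℝ · (EuclideanSpace.single (v 0) (1:ℝ))) g, ?_, ?_⟩
    · intro x
      have : (fun x : EuclideanSpace ℝ (Fin n) => inner ℝ x (EuclideanSpace.single (v 0) (1:ℝ))).HasTemperateGrowth := by fun_prop
      rw [smul_apply, smulLeftCLM_apply_apply this, hg]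
      simp [EuclideanSpace.inner_single_right]
      ring
    · rw [← lineDerivOp_fourierInv_eq, ← hd, iteratedLineDerivOp_succ_left]
      rfl

lemma aux_taylor {E : Type*} [NormedAddCommGroup E] [NormedSpace ℝ E] (N : ℕ)
    (φ : SchwartzMap E ℂ) (h : ∀ m ≤ N, iteratedFDeriv ℝ m φ 0 = 0) (j : ℕ) :
    ∀ l, l + j = N + 1 → ∃ C, 0 ≤ C ∧ ∀ x, ‖iteratedFDeriv ℝ l φ x‖ ≤ C * ‖x‖ ^ j := by
  induction j with
  | zero =>
    intro l _
    refine ⟨SchwartzMap.seminorm ℝ 0 l φ, apply_nonneg _ _, fun x => ?_⟩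
    simpa using SchwartzMap.le_seminorm ℝ 0 l φ x
  | succ j ih =>
    intro l hl
    obtain ⟨C, hC, hb⟩ := ih (l + 1) (by omega)
    refine ⟨C, hC, fun x => ?_⟩
    have hd : Differentiable ℝ (iteratedFDeriv ℝ l φ) :=
      (φ.smooth ⊤).differentiable_iteratedFDeriv (mod_cast ENat.natCast_lt_top l)
    have := (convex_closedBall (0 : E) ‖x‖).norm_image_sub_le_of_norm_fderiv_le (𝕜 := ℝ)
      (f := iteratedFDeriv ℝ l φ) (C := C * ‖x‖ ^ j) (x := 0) (y := x)
      (fun y _ => hd y) (fun y hy => by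
        rw [norm_fderiv_iteratedFDeriv]
        refine (hb y).trans ?_
        have : ‖y‖ ≤ ‖x‖ := by simpa using hy
        gcongr) (by simp) (by simp)
    rw [h l (by omega), sub_zero, sub_zero] at this
    rw [pow_succ, ← mul_assoc]; exact this

lemma aux_cutoff {E : Type*} [NormedAddCommGroup E] [NormedSpace ℝ E] [FiniteDimensional ℝ E]
    (N : ℕ) (φ : SchwartzMap E ℂ) (h : ∀ m ≤ N, iteratedFDeriv ℝ m φ 0 = 0) (χ : E → ℝ)
    (hχ : ContDiff ℝ (⊤ : ℕ∞) χ) (hs : tsupport χ ⊆ Metric.closedBall 0 2)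
    (k l : ℕ) (hl : l ≤ N) :
    ∃ K, 0 ≤ K ∧ ∀ ε, 0 < ε → ε ≤ 1 → ∀ x,
      ‖x‖ ^ k * ‖iteratedFDeriv ℝ l (fun y => χ (ε⁻¹ • y) • φ y) x‖ ≤ K * ε := by
  have hcs : HasCompactSupport χ :=
    (isCompact_closedBall (0:E) 2).of_isClosed_subset (isClosed_tsupport _) hs
  have h1 : ∀ i, ∃ M, 0 ≤ M ∧ ∀ x, ‖iteratedFDeriv ℝ i χ x‖ ≤ M := fun i => by
    have := SchwartzMap.le_seminorm ℝ 0 i (hcs.toSchwartzMap hχ)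
    refine ⟨SchwartzMap.seminorm ℝ 0 i (hcs.toSchwartzMap hχ), apply_nonneg _ _, fun x => ?_⟩
    have h6 := this x
    rw [pow_zero, one_mul] at h6
    exact h6
  have h2 : ∀ i, ∃ C, 0 ≤ C ∧ (i ≤ N → ∀ x, ‖iteratedFDeriv ℝ i φ x‖ ≤ C * ‖x‖ ^ (N + 1 - i)) := fun i => by
    by_cases hi : i ≤ N
    · obtain ⟨C, hC, hb⟩ := aux_taylor N φ h (N + 1 - i) i (by omega)
      exact ⟨C, hC, fun _ => hb⟩
    · exact ⟨0, le_rfl, fun h => absurd h hi⟩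
  choose M hM0 hM using h1
  choose C hC0 hC using h2
  refine ⟨2 ^ k * ∑ i ∈ Finset.range (l + 1),
    (l.choose i : ℝ) * M i * (C (l - i) * 2 ^ (N + 1 - (l - i))), ?_, ?_⟩
  · have : ∀ i, 0 ≤ (l.choose i : ℝ) * M i * (C (l - i) * 2 ^ (N + 1 - (l - i))) := fun i => by
      have := hM0 i; have := hC0 (l - i); positivity
    have := Finset.sum_nonneg (s := Finset.range (l+1)) fun i _ => this i
    positivity
  intro ε hε hε1 x
  by_cases hx : ‖x‖ ≤ 2 * ε
  · have hb := norm_iteratedFDeriv_smul_le (𝕜 := ℝ) (f := fun y => χ (ε⁻¹ • y)) (g := φ) (N := (⊤ : ℕ∞))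
      (by fun_prop) (φ.smooth ⊤) x (n := l) (mod_cast le_top)
    rw [mul_assoc, Finset.sum_mul]
    refine mul_le_mul (pow_le_pow_left₀ (norm_nonneg _) (by linarith) k) (hb.trans ?_)
      (norm_nonneg _) (by positivity)
    refine Finset.sum_le_sum fun i hi => ?_
    rw [Finset.mem_range] at hi
    rw [iteratedFDeriv_comp_const_smul (i := i) (ε⁻¹) (contDiff_infty.1 hχ i)]
    dsimp only
    rw [norm_smul, mul_assoc, mul_assoc (l.choose i : ℝ), mul_assoc (l.choose i : ℝ)]
    refine mul_le_mul_of_nonneg_left ?_ (Nat.cast_nonneg _)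
    have e1 : ‖ε⁻¹ ^ i‖ = (ε ^ i)⁻¹ := by
      rw [norm_pow, Real.norm_of_nonneg (by positivity), inv_pow]
    have e2 := hC (l - i) (by omega) x
    have e3 : ‖x‖ ^ (N + 1 - (l - i)) ≤ (2 * ε) ^ (N + 1 - (l - i)) := by gcongr
    have e4 : ε ^ (N + 1 - (l - i)) ≤ ε ^ i * ε := by
      rw [← pow_succ]
      exact pow_le_pow_of_le_one hε.le hε1 (by omega)
    rw [e1]
    have := hM0 i
    have := hC0 (l - i)
    calc _ ≤ (ε ^ i)⁻¹ * M i * (C (l - i) * (2 * ε) ^ (N + 1 - (l - i))) := by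
          gcongr
          · exact hM i _
          · exact e2.trans (by gcongr)
      _ = (ε ^ i)⁻¹ * M i * (C (l - i) * (2 ^ (N + 1 - (l - i)) * ε ^ (N + 1 - (l - i)))) := by
          rw [mul_pow]
      _ ≤ (ε ^ i)⁻¹ * M i * (C (l - i) * (2 ^ (N + 1 - (l - i)) * (ε ^ i * ε))) := by gcongr
      _ = _ := by field_simp
  · have : iteratedFDeriv ℝ l (fun y => χ (ε⁻¹ • y) • φ y) x = 0 := by
      by_contra hne
      have h3 := support_iteratedFDeriv_subset (𝕜 := ℝ) l (Function.mem_support.2 hne)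
      have h4 : tsupport (fun y => χ (ε⁻¹ • y) • φ y) ⊆ Metric.closedBall 0 (2 * ε) := by
        refine closure_minimal (fun y hy => ?_) Metric.isClosed_closedBall
        have : χ (ε⁻¹ • y) ≠ 0 := fun h0 => hy (by simp [h0])
        have := hs (subset_tsupport _ this)
        rw [mem_closedBall_zero_iff, norm_smul, norm_inv, Real.norm_of_nonneg hε.le,
          inv_mul_le_iff₀ hε] at this
        rw [mem_closedBall_zero_iff]; linarith
      have := h4 h3
      rw [mem_closedBall_zero_iff] at this
      exact hx this
    rw [this]
    have h5 : ∀ i, 0 ≤ (l.choose i : ℝ) * M i * (C (l - i) * 2 ^ (N + 1 - (l - i))) := fun i => by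
      have := hM0 i; have := hC0 (l - i); positivity
    have := Finset.sum_nonneg (s := Finset.range (l+1)) fun i _ => h5 i
    rw [norm_zero, mul_zero]; positivity

lemma aux_order {E : Type*} [NormedAddCommGroup E] [InnerProductSpace ℝ E] [FiniteDimensional ℝ E]
    (S : SchwartzMap E ℂ →L[ℂ] ℂ)
    (hS : ∀ φ : SchwartzMap E ℂ, (∀ᶠ x in nhds (0 : E), φ x = 0) → S φ = 0) :
    ∃ N : ℕ, ∀ φ : SchwartzMap E ℂ, (∀ m ≤ N, iteratedFDeriv ℝ m φ 0 = 0) → S φ = 0 := by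
  obtain ⟨s, C, -, hb⟩ := Seminorm.bound_of_continuous (schwartz_withSeminorms ℂ E ℂ)
    ((normSeminorm ℂ ℂ).comp S.toLinearMap) (continuous_norm.comp S.continuous)
  refine ⟨s.sup Prod.snd, fun φ hφ => ?_⟩
  let χ : ContDiffBump (0 : E) := ⟨1, 2, by norm_num, by norm_num⟩
  have hχ : ContDiff ℝ (⊤ : ℕ∞) χ := χ.contDiff
  have hs : tsupport χ ⊆ Metric.closedBall 0 2 := by rw [χ.tsupport_eq]
  have key : ∀ p : ℕ × ℕ, ∃ K, 0 ≤ K ∧ (p ∈ s → ∀ ε, 0 < ε → ε ≤ 1 → ∀ x,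
      ‖x‖ ^ p.1 * ‖iteratedFDeriv ℝ p.2 (fun y => χ (ε⁻¹ • y) • φ y) x‖ ≤ K * ε) := fun p => by
    by_cases hp : p ∈ s
    · obtain ⟨K, h0, h1⟩ := aux_cutoff _ φ hφ χ hχ hs p.1 p.2 (Finset.le_sup (f := Prod.snd) hp)
      exact ⟨K, h0, fun _ => h1⟩
    · exact ⟨0, le_rfl, fun h => absurd h hp⟩
  choose K hK0 hK using key
  have main : ∀ ε, 0 < ε → ε ≤ 1 → ‖S φ‖ ≤ (C * ∑ p ∈ s, K p) * ε := fun ε hε hε1 => by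
    have ht : (fun y : E => χ (ε⁻¹ • y)).HasTemperateGrowth := by
      refine HasCompactSupport.hasTemperateGrowth ?_ (by fun_prop)
      exact χ.hasCompactSupport.comp_smul (inv_ne_zero hε.ne')
    let f : SchwartzMap E ℂ := smulLeftCLM ℂ (fun y : E => χ (ε⁻¹ • y)) φ
    have hf : (f : E → ℂ) = fun y => χ (ε⁻¹ • y) • φ y := by
      ext y; exact smulLeftCLM_apply_apply ht φ y
    have h0 : S (φ - f) = 0 := by
      refine hS _ ?_
      have : Filter.Tendsto (fun y : E => ε⁻¹ • y) (nhds 0) (nhds 0) := by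
        have : Continuous (fun y : E => ε⁻¹ • y) := by fun_prop
        simpa using this.tendsto 0
      filter_upwards [this.eventually χ.eventuallyEq_one] with y hy
      rw [sub_apply, hf]
      simp [hy]
    rw [map_sub, sub_eq_zero] at h0
    rw [h0]
    refine (hb f).trans ?_
    rw [smul_apply, NNReal.smul_def, smul_eq_mul, mul_assoc]
    refine mul_le_mul_of_nonneg_left ?_ C.2
    have hKs := Finset.sum_nonneg (s := s) fun p _ => hK0 p
    refine Seminorm.finset_sup_apply_le (by positivity) fun p hp => ?_
    refine SchwartzMap.seminorm_le_bound ℂ p.1 p.2 f (by positivity) fun x => ?_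
    rw [hf]
    refine (hK p hp ε hε hε1 x).trans ?_
    gcongr
    exact Finset.single_le_sum (fun p _ => hK0 p) hp
  have hlim : Filter.Tendsto (fun ε : ℝ => (C * ∑ p ∈ s, K p) * ε) (nhdsWithin 0 (Set.Ioi 0)) (nhds 0) := by
    have : Continuous (fun ε : ℝ => (C * ∑ p ∈ s, K p) * ε) := by fun_prop
    simpa using (this.tendsto 0).mono_left nhdsWithin_le_nhds
  have : ‖S φ‖ ≤ 0 := by
    refine ge_of_tendsto hlim ?_
    filter_upwards [Ioc_mem_nhdsGT (zero_lt_one (α := ℝ))] with ε hε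
    exact main ε hε.1 hε.2
  simpa using this

open LineDeriv in
theorem stmt6 (n : ℕ) (hn : 1 ≤ n)
    (T : SchwartzMap (EuclideanSpace ℝ (Fin n)) ℂ →L[ℂ] ℂ)
    (hT : ∀ φ : SchwartzMap (EuclideanSpace ℝ (Fin n)) ℂ,
      (∀ᶠ x in nhds (0 : EuclideanSpace ℝ (Fin n)), φ x = 0) →
      T (fourierTransformCLM ℂ φ) = 0) :
    ∃ P : MvPolynomial (Fin n) ℂ,
      ∀ ψ : SchwartzMap (EuclideanSpace ℝ (Fin n)) ℂ,
        T ψ = ∫ x : EuclideanSpace ℝ (Fin n),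
          MvPolynomial.eval (fun i => ((x i : ℝ) : ℂ)) P * ψ x := by
  obtain ⟨N, hN⟩ := aux_order (T.comp (fourierTransformCLM ℂ)) hT
  let ι := Σ m : Fin (N + 1), (Fin m → Fin n)
  let L : ι → (SchwartzMap (EuclideanSpace ℝ (Fin n)) ℂ →ₗ[ℂ] ℂ) := fun i =>
    (TemperedDistribution.delta (0 : EuclideanSpace ℝ (Fin n))).toLinearMap ∘ₗ
      (iteratedLineDerivOpCLM ℂ (SchwartzMap (EuclideanSpace ℝ (Fin n)) ℂ)
        (fun j => EuclideanSpace.single (i.2 j) (1:ℝ))).toLinearMap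
  have hL : ∀ i φ, L i φ = (∂^{fun j => EuclideanSpace.single (i.2 j) (1:ℝ)} φ :
      SchwartzMap (EuclideanSpace ℝ (Fin n)) ℂ) 0 := fun i φ => rfl
  have hmem : (T.comp (fourierTransformCLM ℂ)).toLinearMap ∈ Submodule.span ℂ (Set.range L) := by
    refine mem_span_of_iInf_ker_le_ker fun φ hφ => ?_
    refine hN φ fun m hm => ?_
    simp only [Submodule.mem_iInf, LinearMap.mem_ker] at hφ
    have : (iteratedFDeriv ℝ m φ 0).toMultilinearMap = 0 := by
      refine Module.Basis.ext_multilinear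
        (fun _ => (EuclideanSpace.basisFun (Fin n) ℝ).toBasis) fun v => ?_
      have := hφ ⟨⟨m, by omega⟩, v⟩
      rw [hL, iteratedLineDerivOp_eq_iteratedFDeriv] at this
      simpa using this
    ext v
    exact congrArg (fun f => f v) this
  obtain ⟨c, hc⟩ := (Submodule.mem_span_range_iff_exists_fun ℂ).1 hmem
  choose P hP using fun i : ι => aux_fourier n i.1 i.2
  refine ⟨∑ i, MvPolynomial.C (c i) * P i, fun ψ => ?_⟩
  choose g hg hd using fun i : ι => hP i ψ
  have h1 : T ψ = ∑ i, c i * L i (𝓕⁻ ψ) := by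
    have := congrArg (fun f => f (𝓕⁻ ψ)) hc
    simp only [LinearMap.sum_apply, LinearMap.smul_apply, smul_eq_mul] at this
    rw [this]
    change _ = T (𝓕 (𝓕⁻ ψ))
    rw [FourierTransform.fourier_fourierInv_eq]
  rw [h1]
  have h2 : ∀ i, L i (𝓕⁻ ψ) = ∫ x, g i x := fun i => by
    rw [hL, hd, fourierInv_coe, Real.fourierInv_eq]
    simp
  simp_rw [h2, ← integral_const_mul]
  rw [← integral_finsetSum _ fun i _ => ((g i).integrable).const_mul _]
  congr 1
  ext x
  simp [hg, Finset.sum_mul, mul_assoc]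
end

section
/- Let n ≥ 1, let P : ℝⁿ → ℂ be a polynomial function, and let g : ℝⁿ → ℂ be a locally integrable function such that g·φ is integrable for every Schwartz function φ. If ∫_{ℝⁿ} P(x) · 𝓕φ(x) dx = ∫_{ℝⁿ} g(ξ) φ(ξ) dξ for every Schwartz function φ, then P = 0 and g vanishes almost everywhere. -/
open MeasureTheory SchwartzMap Real FourierTransform

open scoped ContDiff

open LineDeriv in
lemma exists_polyFourier {n : ℕ} (φ : SchwartzMap (EuclideanSpace ℝ (Fin n)) ℂ)
    (P : MvPolynomial (Fin n) ℂ) :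
    ∃ χ : SchwartzMap (EuclideanSpace ℝ (Fin n)) ℂ, tsupport χ ⊆ tsupport φ ∧
      ∀ x : EuclideanSpace ℝ (Fin n),
        MvPolynomial.eval (fun i => ((x i : ℝ) : ℂ)) P * 𝓕 φ x = 𝓕 χ x := by
  induction P using MvPolynomial.induction_on with
  | C a =>
    refine ⟨a • φ, ?_, fun x => ?_⟩
    · exact closure_mono (Function.support_const_smul_subset a φ)
    · rw [FourierTransform.fourier_smul]
      simp
  | add p q hp hq =>
    obtain ⟨χ₁, h₁, e₁⟩ := hp
    obtain ⟨χ₂, h₂, e₂⟩ := hq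
    refine ⟨χ₁ + χ₂, ?_, fun x => ?_⟩
    · exact (tsupport_add χ₁ χ₂).trans (Set.union_subset h₁ h₂)
    · rw [FourierTransform.fourier_add, add_apply, ← e₁, ← e₂, map_add, add_mul]
  | mul_X p i hp =>
    obtain ⟨χ, h, e⟩ := hp
    refine ⟨(2 * π * Complex.I)⁻¹ • ∂_{EuclideanSpace.single i (1 : ℝ)} χ, ?_, fun x => ?_⟩
    · refine Set.Subset.trans ?_ ((tsupport_lineDerivOp_subset (EuclideanSpace.single i (1 : ℝ)) χ).trans h)
      exact closure_mono (Function.support_const_smul_subset _ _)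
    · have ht : (fun y : EuclideanSpace ℝ (Fin n) =>
          inner ℝ y (EuclideanSpace.single i (1 : ℝ))).HasTemperateGrowth := by fun_prop
      rw [FourierTransform.fourier_smul, fourier_lineDerivOp_eq, smul_smul,
        inv_mul_cancel₀ Complex.two_pi_I_ne_zero, one_smul, smulLeftCLM_apply_apply ht, ← e]
      have hi : inner ℝ x (EuclideanSpace.single i (1 : ℝ)) = x i := by
        rw [EuclideanSpace.inner_single_right]
        simp
      rw [hi]
      simp
      ring

lemma integral_polyFourier_eq_zero {n : ℕ} (φ : SchwartzMap (EuclideanSpace ℝ (Fin n)) ℂ)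
    (P : MvPolynomial (Fin n) ℂ) (h0 : (0 : EuclideanSpace ℝ (Fin n)) ∉ tsupport φ) :
    ∫ x : EuclideanSpace ℝ (Fin n),
      MvPolynomial.eval (fun i => ((x i : ℝ) : ℂ)) P * 𝓕 φ x = 0 := by
  obtain ⟨χ, h, e⟩ := exists_polyFourier φ P
  simp_rw [e]
  have h1 : 𝓕⁻ (𝓕 χ) 0 = χ 0 := by rw [FourierTransform.fourierInv_fourier_eq]
  rw [fourierInv_coe, Real.fourierInv_eq] at h1
  simp only [inner_zero_right, AddChar.map_zero_eq_one, one_smul] at h1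
  rw [h1]
  exact image_eq_zero_of_notMem_tsupport fun hh => h0 (h hh)

/-- If a polynomial distribution and a locally integrable function `g`
agree in the sense that `∫ P(x) 𝓕φ(x) dx = ∫ g(ξ) φ(ξ) dξ` for every Schwartz `φ`,
then `P = 0` and `g = 0` a.e. -/
theorem stmt7 (n : ℕ) (hn : 1 ≤ n) (P : MvPolynomial (Fin n) ℂ)
    (g : EuclideanSpace ℝ (Fin n) → ℂ)
    (hg : LocallyIntegrable g volume)
    (hgint : ∀ φ : SchwartzMap (EuclideanSpace ℝ (Fin n)) ℂ,
      Integrable (fun ξ => g ξ * φ ξ) volume)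
    (heq : ∀ φ : SchwartzMap (EuclideanSpace ℝ (Fin n)) ℂ,
      (∫ x : EuclideanSpace ℝ (Fin n),
          MvPolynomial.eval (fun i => ((x i : ℝ) : ℂ)) P * 𝓕 (⇑φ) x)
        = ∫ ξ : EuclideanSpace ℝ (Fin n), g ξ * φ ξ) :
    P = 0 ∧ ∀ᵐ ξ : EuclideanSpace ℝ (Fin n) ∂volume, g ξ = 0 := by
  have key : ∀ᵐ ξ : EuclideanSpace ℝ (Fin n) ∂volume, g ξ = 0 := by
    have : Nonempty (Fin n) := ⟨⟨0, hn⟩⟩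
    have h1 := (isOpen_compl_singleton (x := (0 : EuclideanSpace ℝ (Fin n)))
      ).ae_eq_zero_of_integral_contDiff_smul_eq_zero (μ := volume)
      (hg.locallyIntegrableOn _) (fun f f_smooth f_cpt f_sub => by
        have hf₁ : HasCompactSupport (Complex.ofRealCLM ∘ f) := f_cpt.comp_left rfl
        have hf₂ : ContDiff ℝ ∞ (Complex.ofRealCLM ∘ f) := by fun_prop
        have h2 := heq (hf₁.toSchwartzMap hf₂)
        have h3 := integral_polyFourier_eq_zero (hf₁.toSchwartzMap hf₂) P (fun hh => by
          have : (0 : EuclideanSpace ℝ (Fin n)) ∈ tsupport f :=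
            closure_mono (Function.support_comp_subset (g := Complex.ofRealCLM) rfl f) hh
          exact f_sub this rfl)
        rw [fourier_coe] at h3
        rw [h3] at h2
        rw [h2]
        refine integral_congr_ae (Filter.Eventually.of_forall fun x => ?_)
        simp [mul_comm])
    have h2 : ∀ᵐ ξ : EuclideanSpace ℝ (Fin n) ∂volume, ξ ≠ 0 := by
      simp [ae_iff]
    filter_upwards [h1, h2] with x hx hx0 using hx hx0
  refine ⟨?_, key⟩
  have hcont : Continuous fun x : EuclideanSpace ℝ (Fin n) =>
      MvPolynomial.eval (fun i => ((x i : ℝ) : ℂ)) P :=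
    (MvPolynomial.continuous_eval P).comp (by fun_prop)
  have hP : ∀ᵐ x : EuclideanSpace ℝ (Fin n) ∂volume,
      MvPolynomial.eval (fun i => ((x i : ℝ) : ℂ)) P = 0 := by
    refine ae_eq_zero_of_integral_contDiff_smul_eq_zero hcont.locallyIntegrable
      fun f f_smooth f_cpt => ?_
    have hf₁ : HasCompactSupport (Complex.ofRealCLM ∘ f) := f_cpt.comp_left rfl
    have hf₂ : ContDiff ℝ ∞ (Complex.ofRealCLM ∘ f) := by fun_prop
    have h2 := heq (𝓕⁻ (hf₁.toSchwartzMap hf₂))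
    rw [← fourier_coe, FourierTransform.fourier_fourierInv_eq] at h2
    have h3 : ∫ ξ, g ξ * (𝓕⁻ (hf₁.toSchwartzMap hf₂)) ξ = 0 := by
      refine integral_eq_zero_of_ae ?_
      filter_upwards [key] with x hx
      simp [hx]
    rw [h3] at h2
    rw [← h2]
    refine integral_congr_ae (Filter.Eventually.of_forall fun x => ?_)
    simp [mul_comm]
  have hP' := (hcont.ae_eq_iff_eq volume (continuous_const (y := (0 : ℂ)))).1 hP
  refine MvPolynomial.funext_set (fun _ => Set.range ((↑) : ℝ → ℂ))
    (fun _ => Set.infinite_range_of_injective Complex.ofReal_injective) fun x hx => ?_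
  choose y hy using fun i => hx i (Set.mem_univ i)
  have := congrFun hP' (WithLp.toLp 2 y)
  simpa [hy] using this
end
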